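/- arXiv:1008.4615 — 2 statements merged into one kernel-verified Lean document; each statement's English description precedes it below -/
import Mathlib

section
/- Suppose λ and μ are partitions with λ ⊑ μ (μ doubly dominates λ) and |μ| − |λ| > 1. Then there exists a partition μ′ with λ ⊑ μ′ ⊑ μ and |μ| − |μ′| = 1. Consequently, the covering pairs of the double domination order are exactly pairs whose sizes differ by 1. -/
/-- A partition: a weakly decreasing sequence of natural numbers (indexed from 0,
with missing parts treated as 0), having only finitely many nonzero parts. -/
structure YPartition where
  parts : ℕ → ℕ
  antitone : ∀ i j : ℕ, i ≤ j → parts j ≤ parts i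
  finite : ∃ N : ℕ, ∀ i : ℕ, N ≤ i → parts i = 0

/-- Partial sum of the first `r` values of `f` (so `psum lam.parts r = λ_1 + ⋯ + λ_r`). -/
def psum (f : ℕ → ℕ) (r : ℕ) : ℕ := ∑ i ∈ Finset.range r, f i

/-- The parts of the conjugate partition: `λ*_{i+1} = |{j : λ_j ≥ i+1}|` (0-indexed). -/
noncomputable def conjParts (p : YPartition) : ℕ → ℕ :=
  fun i => {j : ℕ | i + 1 ≤ p.parts j}.ncard

/-- The size `|λ| = Σ_i λ_i` of a partition. -/
noncomputable def size (p : YPartition) : ℕ := sSup (Set.range (psum p.parts))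

/-- `μ` doubly dominates `lam`: each partial sum of parts of `μ` is at least the
corresponding one for `lam`, and the same for the conjugates. -/
def DoublyDominates (μ lam : YPartition) : Prop :=
  (∀ r : ℕ, psum lam.parts r ≤ psum μ.parts r) ∧
  (∀ r : ℕ, psum (conjParts lam) r ≤ psum (conjParts μ) r)

/-- The positions in `S` form a union of `k` increasing subsequences of `π`. -/
def IsUnionKIncreasing {n : ℕ} (π : Equiv.Perm (Fin n)) (k : ℕ) (S : Finset (Fin n)) : Prop :=
  ∃ c : Fin n → Fin k, ∀ i ∈ S, ∀ j ∈ S, i < j → c i = c j → π i < π j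

/-- The positions in `S` form a union of `k` decreasing subsequences of `π`. -/
def IsUnionKDecreasing {n : ℕ} (π : Equiv.Perm (Fin n)) (k : ℕ) (S : Finset (Fin n)) : Prop :=
  ∃ c : Fin n → Fin k, ∀ i ∈ S, ∀ j ∈ S, i < j → c i = c j → π j < π i

/-- `I_k(π)`: the maximum size of a set of positions of `π` that is a union of `k`
increasing subsequences. -/
noncomputable def incMax {n : ℕ} (π : Equiv.Perm (Fin n)) (k : ℕ) : ℕ :=
  sSup {m : ℕ | ∃ S : Finset (Fin n), IsUnionKIncreasing π k S ∧ S.card = m}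

/-- `D_k(π)`: the maximum size of a set of positions of `π` that is a union of `k`
decreasing subsequences. -/
noncomputable def decMax {n : ℕ} (π : Equiv.Perm (Fin n)) (k : ℕ) : ℕ :=
  sSup {m : ℕ | ∃ S : Finset (Fin n), IsUnionKDecreasing π k S ∧ S.card = m}

/-- `σ` is involved in `π` (`σ ≼ π`): some subsequence of the values of `π` is in the
same relative order as the values of `σ`. -/
def Involved {m n : ℕ} (σ : Equiv.Perm (Fin m)) (π : Equiv.Perm (Fin n)) : Prop :=
  ∃ f : Fin m → Fin n, StrictMono f ∧ ∀ i j : Fin m, σ i < σ j ↔ π (f i) < π (f j)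

/-- `π` has RSK shape `lam`, characterized via Greene's theorem:
`λ_1 + ⋯ + λ_k = I_k(π)` and `λ*_1 + ⋯ + λ*_k = D_k(π)` for all `k`. -/
def HasShape {n : ℕ} (π : Equiv.Perm (Fin n)) (lam : YPartition) : Prop :=
  ∀ k : ℕ, psum lam.parts k = incMax π k ∧ psum (conjParts lam) k = decMax π k

theorem psum_succ (f : ℕ → ℕ) (r : ℕ) : psum f (r + 1) = psum f r + f r :=
  Finset.sum_range_succ f r

theorem psum_mono (f : ℕ → ℕ) : Monotone (psum f) :=
  monotone_nat_of_le_succ fun r => by rw [psum_succ]; omega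

theorem psum_eq_of_le {f : ℕ → ℕ} {N r : ℕ} (hN : ∀ i, N ≤ i → f i = 0) (hr : N ≤ r) :
    psum f r = psum f N := by
  induction r, hr using Nat.le_induction with
  | base => rfl
  | succ k hk ih => rw [psum_succ, hN k hk, ih, add_zero]

theorem size_eq_psum {p : YPartition} {N : ℕ} (hN : ∀ i, N ≤ i → p.parts i = 0) :
    size p = psum p.parts N := by
  refine IsGreatest.csSup_eq ⟨⟨N, rfl⟩, ?_⟩
  rintro _ ⟨r, rfl⟩
  rcases le_total r N with h | h
  · exact psum_mono _ h
  · exact (psum_eq_of_le hN h).le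

theorem conjParts_eq_sum {p : YPartition} {N : ℕ} (hN : ∀ i, N ≤ i → p.parts i = 0) (i : ℕ) :
    conjParts p i = ∑ j ∈ Finset.range N, if i + 1 ≤ p.parts j then 1 else 0 := by
  have hset : {j : ℕ | i + 1 ≤ p.parts j} =
      ((Finset.range N).filter fun j => i + 1 ≤ p.parts j : Finset ℕ) := by
    ext j
    simp only [Set.mem_ofPred_eq, Finset.coe_filter, Finset.mem_range]
    refine ⟨fun h => ⟨?_, h⟩, fun h => h.2⟩
    by_contra hj
    have := hN j (by omega)
    omega
  rw [conjParts, hset, Set.ncard_coe_finset, Finset.card_filter]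

theorem sum_range_ite_succ_le (x s : ℕ) :
    (∑ i ∈ Finset.range s, if i + 1 ≤ x then 1 else 0) = min x s := by
  induction s with
  | zero => simp
  | succ s ih =>
    rw [Finset.sum_range_succ, ih]
    split_ifs <;> omega

theorem psum_conjParts_eq_sum_min {p : YPartition} {N : ℕ}
    (hN : ∀ i, N ≤ i → p.parts i = 0) (s : ℕ) :
    psum (conjParts p) s = ∑ j ∈ Finset.range N, min (p.parts j) s := by
  simp only [psum, conjParts_eq_sum hN]
  rw [Finset.sum_comm]
  simp only [sum_range_ite_succ_le]

theorem YPartition.exists_bound_ge (p : YPartition) (r : ℕ) :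
    ∃ N, r ≤ N ∧ ∀ i, N ≤ i → p.parts i = 0 := by
  obtain ⟨N, hN⟩ := p.finite
  exact ⟨max r N, le_max_left _ _, fun i hi => hN i ((le_max_right _ _).trans hi)⟩

theorem psum_conjParts_add_psum_le (p : YPartition) (r s : ℕ) :
    psum (conjParts p) s + psum p.parts r ≤ r * s + size p := by
  obtain ⟨N, hr, hN⟩ := p.exists_bound_ge r
  rw [psum_conjParts_eq_sum_min hN, size_eq_psum hN, psum, psum,
    ← Finset.sum_range_add_sum_Ico _ hr, ← Finset.sum_range_add_sum_Ico p.parts hr]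
  have h₁ : ∑ j ∈ Finset.range r, min (p.parts j) s ≤ r * s := by
    simpa using Finset.sum_le_card_nsmul (Finset.range r) (fun j => min (p.parts j) s) s
      fun j _ => min_le_right _ _
  have h₂ : ∑ j ∈ Finset.Ico r N, min (p.parts j) s ≤ ∑ j ∈ Finset.Ico r N, p.parts j :=
    Finset.sum_le_sum fun j _ => min_le_left _ _
  omega

theorem psum_conjParts_add_psum_eq (p : YPartition) {r s : ℕ}
    (hlt : ∀ i, i < r → s ≤ p.parts i) (hge : ∀ i, r ≤ i → p.parts i ≤ s) :
    psum (conjParts p) s + psum p.parts r = r * s + size p := by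
  obtain ⟨N, hr, hN⟩ := p.exists_bound_ge r
  rw [psum_conjParts_eq_sum_min hN, size_eq_psum hN, psum, psum,
    ← Finset.sum_range_add_sum_Ico _ hr, ← Finset.sum_range_add_sum_Ico p.parts hr]
  have h₁ : ∑ j ∈ Finset.range r, min (p.parts j) s = r * s := by
    rw [Finset.sum_congr rfl fun j hj => min_eq_right (hlt j (Finset.mem_range.1 hj))]
    simp
  have h₂ : ∑ j ∈ Finset.Ico r N, min (p.parts j) s = ∑ j ∈ Finset.Ico r N, p.parts j :=
    Finset.sum_congr rfl fun j hj => min_eq_left (hge j (Finset.mem_Ico.1 hj).1)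
  omega

/-- Domination of conjugates amounts to comparing the tail sums of the parts. -/
theorem psum_conjParts_le_iff (lam μ : YPartition) :
    (∀ s, psum (conjParts lam) s ≤ psum (conjParts μ) s) ↔
      ∀ r, size lam + psum μ.parts r ≤ size μ + psum lam.parts r := by
  constructor
  · intro h r
    have h₁ := psum_conjParts_add_psum_eq lam (r := r) (s := lam.parts r)
      (fun i hi => lam.antitone i r hi.le) (fun i hi => lam.antitone r i hi)
    have h₂ := psum_conjParts_add_psum_le μ r (lam.parts r)
    have h₃ := h (lam.parts r)
    omega
  · intro h s
    have hex : ∃ r, μ.parts r ≤ s := by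
      obtain ⟨N, hN⟩ := μ.finite
      exact ⟨N, by rw [hN N le_rfl]; exact Nat.zero_le s⟩
    have h₁ := psum_conjParts_add_psum_eq μ (r := Nat.find hex) (s := s)
      (fun i hi => (not_le.1 (Nat.find_min hex hi)).le)
      (fun i hi => (μ.antitone _ i hi).trans (Nat.find_spec hex))
    have h₂ := psum_conjParts_add_psum_le lam (Nat.find hex) s
    have h₃ := h (Nat.find hex)
    omega

theorem doublyDominates_iff (lam μ : YPartition) :
    DoublyDominates μ lam ↔ ∀ r, psum lam.parts r ≤ psum μ.parts r ∧
      size lam + psum μ.parts r ≤ size μ + psum lam.parts r := by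
  rw [DoublyDominates, psum_conjParts_le_iff, forall_and]

/-- The pointwise minimum of the partial sums of one partition and of a translate of those of
another is again the sequence of partial sums of a partition. -/
theorem exists_psum_eq_min (lam μ : YPartition) (c : ℕ) :
    ∃ p : YPartition, (∀ r, psum p.parts r = min (psum μ.parts r) (psum lam.parts r + c)) ∧
      size p = min (size μ) (size lam + c) := by
  obtain ⟨N₁, hN₁⟩ := μ.finite
  obtain ⟨N, hle, hN⟩ := lam.exists_bound_ge N₁
  have hμ : ∀ i, N ≤ i → μ.parts i = 0 := fun i hi => hN₁ i (hle.trans hi)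
  let m : ℕ → ℕ := fun r => min (psum μ.parts r) (psum lam.parts r + c)
  have hzero : ∀ i, N ≤ i → m (i + 1) - m i = 0 := fun i hi => by
    simp only [m, psum_succ, hN i hi, hμ i hi]
    omega
  let p : YPartition :=
    { parts := fun r => m (r + 1) - m r
      antitone := fun i j hij => antitone_nat_of_succ_le (f := fun r => m (r + 1) - m r)
        (fun r => by
          have h₁ := μ.antitone r (r + 1) r.le_succ
          have h₂ := lam.antitone r (r + 1) r.le_succ
          simp only [m, psum_succ]
          omega) hij
      finite := ⟨N, hzero⟩ }
  have hp : ∀ r, psum p.parts r = m r := fun r => by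
    induction r with
    | zero => simp [m, psum]
    | succ r ih =>
      rw [psum_succ, ih]
      simp only [p, m, psum_succ]
      omega
  refine ⟨p, hp, ?_⟩
  rw [size_eq_psum (p := p) hzero, hp, size_eq_psum hN, size_eq_psum hμ]

theorem double_domination_cover_step (lam μ : YPartition)
    (hdom : DoublyDominates μ lam) (hsize : 1 < size μ - size lam) :
    ∃ μ' : YPartition, DoublyDominates μ' lam ∧ DoublyDominates μ μ' ∧
      size μ - size μ' = 1 := by
  rw [doublyDominates_iff] at hdom
  obtain ⟨p, hp, hsz⟩ := exists_psum_eq_min lam μ (size μ - size lam - 1)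
  refine ⟨p, (doublyDominates_iff _ _).2 fun r => ?_, (doublyDominates_iff _ _).2 fun r => ?_, ?_⟩
  · have := hdom r
    rw [hp, hsz]
    omega
  · have := hdom r
    rw [hp, hsz]
    omega
  · omega
end

section
/- For any permutations α and β, the RSK shape of the skew sum α ⊖ β is the conjugate sum of the shapes of α and β: sh(α ⊖ β) = sh(α) +* sh(β). Equivalently, for every k ≥ 1, the maximum length of a subsequence of α ⊖ β that is a union of k decreasing subsequences equals the sum of the corresponding maxima for α and for β. -/
/-- Skew sum `α ⊖ β`: `α` with all values shifted up by `m`, followed by `β`. -/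
def skewSum {n m : ℕ} (α : Equiv.Perm (Fin n)) (β : Equiv.Perm (Fin m)) :
    Equiv.Perm (Fin (n + m)) :=
  finSumFinEquiv.symm.trans (((Equiv.sumCongr α β).trans (Equiv.sumComm (Fin n) (Fin m))).trans
    (finSumFinEquiv.trans (finCongr (Nat.add_comm m n))))

/-! ### Conjugate partitions and partial sums -/

theorem lt_parts_iff_lt_conjParts (p : YPartition) (t j : ℕ) :
    t < p.parts j ↔ j < conjParts p t := by
  classical
  obtain ⟨N, hN⟩ := p.finite
  have hex : ∃ j, ¬ t < p.parts j := ⟨N, by simp [hN N le_rfl]⟩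
  have hset : {j : ℕ | t + 1 ≤ p.parts j} = Set.Iio (Nat.find hex) := by
    ext j
    simp only [Set.mem_ofPred_eq, Set.mem_Iio]
    constructor
    · intro h
      by_contra hj
      have h1 := p.antitone _ _ (not_lt.mp hj)
      have h2 := Nat.find_spec hex
      omega
    · intro h
      have := Nat.find_min hex h
      omega
  have hc : conjParts p t = Nat.find hex := by
    unfold conjParts
    rw [hset, ← Finset.coe_Iio, Set.ncard_coe_finset, Nat.card_Iio]
  rw [hc]
  exact (Set.ext_iff.mp hset j : _ ↔ _)

theorem conjParts_antitone (p : YPartition) : Antitone (conjParts p) := by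
  intro s t hst
  by_contra! h
  have h1 := (lt_parts_iff_lt_conjParts p t _).mpr h
  exact lt_irrefl _ ((lt_parts_iff_lt_conjParts p s _).mp (lt_of_le_of_lt hst h1))

theorem conjParts_eq_zero (p : YPartition) {t : ℕ} (h : p.parts 0 ≤ t) : conjParts p t = 0 := by
  have := lt_parts_iff_lt_conjParts p t 0
  omega

theorem psum_parts_eq_sum_min (p : YPartition) {N : ℕ} (hN : p.parts 0 ≤ N) (r : ℕ) :
    psum p.parts r = ∑ t ∈ Finset.range N, min r (conjParts p t) := by
  have hparts (j : ℕ) :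
      p.parts j = ∑ t ∈ Finset.range N, if j < conjParts p t then 1 else 0 := by
    have hj := p.antitone 0 j (Nat.zero_le j)
    rw [← Finset.card_filter]
    have : (Finset.range N).filter (fun t => j < conjParts p t) = Finset.range (p.parts j) := by
      ext t
      simp only [Finset.mem_filter, Finset.mem_range, ← lt_parts_iff_lt_conjParts]
      omega
    rw [this, Finset.card_range]
  unfold psum
  rw [Finset.sum_congr rfl fun j _ => hparts j, Finset.sum_comm]
  refine Finset.sum_congr rfl fun t _ => ?_
  rw [← Finset.card_filter]
  have : (Finset.range r).filter (fun j => j < conjParts p t)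
      = Finset.range (min r (conjParts p t)) := by
    ext j
    simp
  rw [this, Finset.card_range]

theorem psum_add_psum_le_of_conjParts_eq_add {lam mu nu : YPartition}
    (h : ∀ i : ℕ, conjParts nu i = conjParts lam i + conjParts mu i) (i j : ℕ) :
    psum lam.parts i + psum mu.parts j ≤ psum nu.parts (i + j) := by
  have hl : lam.parts 0 ≤ lam.parts 0 + mu.parts 0 + nu.parts 0 := by omega
  have hm : mu.parts 0 ≤ lam.parts 0 + mu.parts 0 + nu.parts 0 := by omega
  have hn : nu.parts 0 ≤ lam.parts 0 + mu.parts 0 + nu.parts 0 := by omega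
  rw [psum_parts_eq_sum_min lam hl, psum_parts_eq_sum_min mu hm, psum_parts_eq_sum_min nu hn,
    ← Finset.sum_add_distrib]
  refine Finset.sum_le_sum fun t _ => ?_
  rw [h t]
  omega

theorem exists_psum_le_psum_add_psum_of_conjParts_eq_add {lam mu nu : YPartition}
    (h : ∀ i : ℕ, conjParts nu i = conjParts lam i + conjParts mu i) (k : ℕ) :
    ∃ i j : ℕ, i + j = k ∧ psum nu.parts k ≤ psum lam.parts i + psum mu.parts j := by
  classical
  have hl : lam.parts 0 ≤ lam.parts 0 + mu.parts 0 + nu.parts 0 := by omega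
  have hm : mu.parts 0 ≤ lam.parts 0 + mu.parts 0 + nu.parts 0 := by omega
  have hn : nu.parts 0 ≤ lam.parts 0 + mu.parts 0 + nu.parts 0 := by omega
  have hex : ∃ t, conjParts lam t + conjParts mu t ≤ k :=
    ⟨nu.parts 0, by rw [← h, conjParts_eq_zero nu le_rfl]; omega⟩
  obtain ⟨i, j, hij, hi, hj, hlt⟩ : ∃ i j : ℕ, i + j = k ∧
      conjParts lam (Nat.find hex) ≤ i ∧ conjParts mu (Nat.find hex) ≤ j ∧
      ∀ t < Nat.find hex, i ≤ conjParts lam t ∧ j ≤ conjParts mu t := by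
    have hs := Nat.find_spec hex
    rcases Nat.eq_zero_or_pos (Nat.find hex) with h0 | hpos
    · exact ⟨conjParts lam (Nat.find hex), k - conjParts lam (Nat.find hex), by omega, le_rfl,
        by omega, fun t ht => by omega⟩
    · have hp := Nat.find_min hex (Nat.sub_lt hpos one_pos)
      have h1 := conjParts_antitone lam (Nat.sub_le (Nat.find hex) 1)
      have h2 := conjParts_antitone mu (Nat.sub_le (Nat.find hex) 1)
      refine ⟨min (conjParts lam (Nat.find hex - 1)) (k - conjParts mu (Nat.find hex)),
        k - min (conjParts lam (Nat.find hex - 1)) (k - conjParts mu (Nat.find hex)),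
        by omega, by omega, by omega, fun t ht => ?_⟩
      have h3 := conjParts_antitone lam (Nat.le_sub_one_of_lt ht)
      have h4 := conjParts_antitone mu (Nat.le_sub_one_of_lt ht)
      omega
  refine ⟨i, j, hij, ?_⟩
  rw [psum_parts_eq_sum_min lam hl, psum_parts_eq_sum_min mu hm, psum_parts_eq_sum_min nu hn,
    ← Finset.sum_add_distrib]
  refine Finset.sum_le_sum fun t _ => ?_
  rw [h t]
  rcases lt_or_ge t (Nat.find hex) with ht | ht
  · have := hlt t ht
    omega
  · have h1 := conjParts_antitone lam ht
    have h2 := conjParts_antitone mu ht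
    omega

/-! ### Maximal unions of chains for a relation on positions -/

/-- The colouring `c` splits the positions in `S` into classes on each of which `R` holds
between any earlier and any later position. -/
def IsChainColoring {n : ℕ} (R : Fin n → Fin n → Prop) (S : Finset (Fin n)) (c : Fin n → ℕ) :
    Prop :=
  ∀ i ∈ S, ∀ j ∈ S, i < j → c i = c j → R i j

/-- The maximum size of a set of positions which is a union of `k` chains for `R`. -/
noncomputable def chainMax {n : ℕ} (R : Fin n → Fin n → Prop) (k : ℕ) : ℕ :=
  sSup {s : ℕ | ∃ S : Finset (Fin n),
    (∃ c : Fin n → Fin k, ∀ i ∈ S, ∀ j ∈ S, i < j → c i = c j → R i j) ∧ S.card = s}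

theorem incMax_eq_chainMax {n : ℕ} (π : Equiv.Perm (Fin n)) (k : ℕ) :
    incMax π k = chainMax (fun i j => π i < π j) k := rfl

theorem decMax_eq_chainMax {n : ℕ} (π : Equiv.Perm (Fin n)) (k : ℕ) :
    decMax π k = chainMax (fun i j => π j < π i) k := rfl

theorem exists_isChainColoring_card_eq_chainMax {n : ℕ} (R : Fin n → Fin n → Prop) (k : ℕ) :
    ∃ (S : Finset (Fin n)) (c : Fin n → ℕ), S.card = chainMax R k ∧ (∀ i ∈ S, c i < k) ∧
      IsChainColoring R S c := by
  set T := {s : ℕ | ∃ S : Finset (Fin n),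
    (∃ c : Fin n → Fin k, ∀ i ∈ S, ∀ j ∈ S, i < j → c i = c j → R i j) ∧ S.card = s} with hT
  rcases T.eq_empty_or_nonempty with hE | hne
  · refine ⟨∅, fun _ => 0, ?_, by simp, by simp [IsChainColoring]⟩
    change _ = sSup T
    simp [hE]
  · have hb : BddAbove T := ⟨n, by
      rintro s ⟨S, -, rfl⟩
      simpa using S.card_le_univ⟩
    obtain ⟨S, ⟨c, hc⟩, hS⟩ := Nat.sSup_mem hne hb
    exact ⟨S, fun i => c i, hS, fun i _ => (c i).2,
      fun i hi j hj hij hcc => hc i hi j hj hij (Fin.ext hcc)⟩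

theorem card_le_chainMax {n : ℕ} {R : Fin n → Fin n → Prop} {S : Finset (Fin n)} {c : Fin n → ℕ}
    (hc : IsChainColoring R S c) {A : Finset ℕ} (hA : ∀ i ∈ S, c i ∈ A) :
    S.card ≤ chainMax R A.card := by
  rcases S.eq_empty_or_nonempty with rfl | ⟨a, ha⟩
  · simp
  · refine le_csSup ⟨n, ?_⟩ ⟨S, ⟨fun i =>
      if h : c i ∈ A then A.equivFin ⟨c i, h⟩ else A.equivFin ⟨c a, hA a ha⟩, ?_⟩, rfl⟩
    · rintro s ⟨S, -, rfl⟩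
      simpa using S.card_le_univ
    · intro i hi j hj hij h
      simp only at h
      rw [dif_pos (hA i hi), dif_pos (hA j hj)] at h
      exact hc i hi j hj hij (Subtype.ext_iff.mp (A.equivFin.injective h))

theorem card_le_chainMax_of_lt {n : ℕ} {R : Fin n → Fin n → Prop} {S : Finset (Fin n)}
    {c : Fin n → ℕ} {k : ℕ} (hc : IsChainColoring R S c) (hk : ∀ i ∈ S, c i < k) :
    S.card ≤ chainMax R k := by
  simpa using card_le_chainMax hc (A := Finset.range k) (by simpa using hk)

section Append

variable {n m : ℕ}

theorem card_eq_card_filter_castAdd_add_card_filter_natAdd (S : Finset (Fin (n + m))) :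
    S.card = (Finset.univ.filter fun i : Fin n => Fin.castAdd m i ∈ S).card +
      (Finset.univ.filter fun j : Fin m => Fin.natAdd n j ∈ S).card := by
  have : S.card = ∑ i : Fin (n + m), if i ∈ S then 1 else 0 := by
    rw [← Finset.card_filter, Finset.filter_mem_eq_inter, Finset.univ_inter]
  rw [this, Fin.sum_univ_add, Finset.card_filter, Finset.card_filter]

theorem exists_finset_append (S : Finset (Fin n)) (T : Finset (Fin m)) :
    ∃ U : Finset (Fin (n + m)), (∀ i, Fin.castAdd m i ∈ U ↔ i ∈ S) ∧
      (∀ j, Fin.natAdd n j ∈ U ↔ j ∈ T) ∧ U.card = S.card + T.card := by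
  classical
  have h1 (i : Fin n) : Fin.castAdd m i ∈ Finset.univ.filter (fun x : Fin (n + m) =>
      Fin.addCases (motive := fun _ => Prop) (· ∈ S) (· ∈ T) x) ↔ i ∈ S := by simp
  have h2 (j : Fin m) : Fin.natAdd n j ∈ Finset.univ.filter (fun x : Fin (n + m) =>
      Fin.addCases (motive := fun _ => Prop) (· ∈ S) (· ∈ T) x) ↔ j ∈ T := by simp
  refine ⟨_, h1, h2, ?_⟩
  rw [card_eq_card_filter_castAdd_add_card_filter_natAdd]
  simp only [h1, h2]
  simp

variable {R : Fin (n + m) → Fin (n + m) → Prop}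

theorem IsChainColoring.castAdd {S : Finset (Fin (n + m))} {c : Fin (n + m) → ℕ}
    (hc : IsChainColoring R S c) :
    IsChainColoring (fun i j => R (Fin.castAdd m i) (Fin.castAdd m j))
      (Finset.univ.filter fun i => Fin.castAdd m i ∈ S) (fun i => c (Fin.castAdd m i)) :=
  fun i hi j hj hij h => hc _ (by simpa using hi) _ (by simpa using hj)
    hij h

theorem IsChainColoring.natAdd {S : Finset (Fin (n + m))} {c : Fin (n + m) → ℕ}
    (hc : IsChainColoring R S c) :
    IsChainColoring (fun i j => R (Fin.natAdd n i) (Fin.natAdd n j))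
      (Finset.univ.filter fun j => Fin.natAdd n j ∈ S) (fun j => c (Fin.natAdd n j)) :=
  fun i hi j hj hij h => hc _ (by simpa using hi) _ (by simpa using hj)
    (by simpa using hij) h

theorem card_add_card_le_chainMax {S : Finset (Fin n)} {T : Finset (Fin m)} {c : Fin n → ℕ}
    {d : Fin m → ℕ} {k : ℕ}
    (hc : IsChainColoring (fun i j => R (Fin.castAdd m i) (Fin.castAdd m j)) S c)
    (hd : IsChainColoring (fun i j => R (Fin.natAdd n i) (Fin.natAdd n j)) T d)
    (hck : ∀ i ∈ S, c i < k) (hdk : ∀ j ∈ T, d j < k)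
    (hcd : ∀ i ∈ S, ∀ j ∈ T, c i = d j → R (Fin.castAdd m i) (Fin.natAdd n j)) :
    S.card + T.card ≤ chainMax R k := by
  obtain ⟨U, hS, hT, hU⟩ := exists_finset_append S T
  rw [← hU]
  refine card_le_chainMax_of_lt (c := Fin.append c d) (fun x hx y hy hxy h => ?_) fun x hx => ?_
  · induction x using Fin.addCases with
    | left i =>
      induction y using Fin.addCases with
      | left j =>
        exact hc i ((hS i).mp hx) j ((hS j).mp hy) hxy
          (by simpa using h)
      | right j => exact hcd i ((hS i).mp hx) j ((hT j).mp hy) (by simpa using h)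
    | right i =>
      induction y using Fin.addCases with
      | left j =>
        have := j.2
        simp only [Fin.lt_def, Fin.val_natAdd, Fin.val_castAdd] at hxy
        omega
      | right j =>
        exact hd i ((hT i).mp hx) j ((hT j).mp hy) (by simpa using hxy)
          (by simpa using h)
  · induction x using Fin.addCases with
    | left i => simpa using hck i ((hS i).mp hx)
    | right j => simpa using hdk j ((hT j).mp hx)

theorem chainMax_eq_add_of_forall (h : ∀ i j, R (Fin.castAdd m i) (Fin.natAdd n j)) (k : ℕ) :
    chainMax R k = chainMax (fun i j => R (Fin.castAdd m i) (Fin.castAdd m j)) k +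
      chainMax (fun i j => R (Fin.natAdd n i) (Fin.natAdd n j)) k := by
  apply le_antisymm
  · obtain ⟨S, c, hS, hk, hc⟩ := exists_isChainColoring_card_eq_chainMax R k
    rw [← hS, card_eq_card_filter_castAdd_add_card_filter_natAdd]
    exact add_le_add
      (card_le_chainMax_of_lt hc.castAdd fun i hi => hk _ (by simpa using hi))
      (card_le_chainMax_of_lt hc.natAdd fun i hi => hk _ (by simpa using hi))
  · obtain ⟨S, c, hS, hck, hc⟩ := exists_isChainColoring_card_eq_chainMax
      (fun i j => R (Fin.castAdd m i) (Fin.castAdd m j)) k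
    obtain ⟨T, d, hT, hdk, hd⟩ := exists_isChainColoring_card_eq_chainMax
      (fun i j => R (Fin.natAdd n i) (Fin.natAdd n j)) k
    rw [← hS, ← hT]
    exact card_add_card_le_chainMax hc hd hck hdk fun i _ j _ _ => h i j

theorem chainMax_add_chainMax_le (R : Fin (n + m) → Fin (n + m) → Prop) (k l : ℕ) :
    chainMax (fun i j => R (Fin.castAdd m i) (Fin.castAdd m j)) k +
      chainMax (fun i j => R (Fin.natAdd n i) (Fin.natAdd n j)) l ≤ chainMax R (k + l) := by
  obtain ⟨S, c, hS, hck, hc⟩ := exists_isChainColoring_card_eq_chainMax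
    (fun i j => R (Fin.castAdd m i) (Fin.castAdd m j)) k
  obtain ⟨T, d, hT, hdl, hd⟩ := exists_isChainColoring_card_eq_chainMax
    (fun i j => R (Fin.natAdd n i) (Fin.natAdd n j)) l
  rw [← hS, ← hT]
  refine card_add_card_le_chainMax (d := fun j => k + d j) hc
    (fun i hi j hj hij h => hd i hi j hj hij (Nat.add_left_cancel h))
    (fun i hi => (hck i hi).trans_le (Nat.le_add_right k l))
    (fun j hj => Nat.add_lt_add_left (hdl j hj) k) fun i hi j _ h => ?_
  have := hck i hi
  omega

theorem exists_chainMax_le_add (h : ∀ i j, ¬ R (Fin.castAdd m i) (Fin.natAdd n j)) (k : ℕ) :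
    ∃ a b : ℕ, a + b ≤ k ∧
      chainMax R k ≤ chainMax (fun i j => R (Fin.castAdd m i) (Fin.castAdd m j)) a +
        chainMax (fun i j => R (Fin.natAdd n i) (Fin.natAdd n j)) b := by
  classical
  obtain ⟨S, c, hS, hk, hc⟩ := exists_isChainColoring_card_eq_chainMax R k
  set A := (Finset.univ.filter fun i : Fin n => Fin.castAdd m i ∈ S).image
    fun i => c (Fin.castAdd m i) with hA
  set B := (Finset.univ.filter fun j : Fin m => Fin.natAdd n j ∈ S).image
    fun j => c (Fin.natAdd n j) with hB
  have hdisj : Disjoint A B := by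
    rw [Finset.disjoint_left]
    intro x hxA hxB
    simp only [hA, hB, Finset.mem_image, Finset.mem_filter, Finset.mem_univ, true_and] at hxA hxB
    obtain ⟨i, hi, rfl⟩ := hxA
    obtain ⟨j, hj, hij⟩ := hxB
    refine h i j (hc _ hi _ hj ?_ hij.symm)
    have := i.2
    simp only [Fin.lt_def, Fin.val_natAdd, Fin.val_castAdd]
    omega
  refine ⟨A.card, B.card, ?_, ?_⟩
  · rw [← Finset.card_union_of_disjoint hdisj, ← Finset.card_range k]
    refine Finset.card_le_card fun x hx => Finset.mem_range.mpr ?_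
    simp only [hA, hB, Finset.mem_union, Finset.mem_image, Finset.mem_filter, Finset.mem_univ,
      true_and] at hx
    rcases hx with ⟨i, hi, rfl⟩ | ⟨i, hi, rfl⟩ <;> exact hk _ hi
  · rw [← hS, card_eq_card_filter_castAdd_add_card_filter_natAdd]
    exact add_le_add
      (card_le_chainMax hc.castAdd fun i hi => Finset.mem_image_of_mem _ hi)
      (card_le_chainMax hc.natAdd fun i hi => Finset.mem_image_of_mem _ hi)

end Append

/-! ### Skew sums -/

section SkewSum

variable {n m : ℕ} (α : Equiv.Perm (Fin n)) (β : Equiv.Perm (Fin m))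

theorem val_skewSum_castAdd (i : Fin n) : (skewSum α β (Fin.castAdd m i) : ℕ) = m + α i := by
  simp [skewSum, add_comm]

theorem val_skewSum_natAdd (j : Fin m) : (skewSum α β (Fin.natAdd n j) : ℕ) = β j := by
  simp [skewSum]

theorem skewSum_natAdd_lt_castAdd (i : Fin n) (j : Fin m) :
    skewSum α β (Fin.natAdd n j) < skewSum α β (Fin.castAdd m i) := by
  rw [Fin.lt_def, val_skewSum_castAdd, val_skewSum_natAdd]
  omega

theorem skewSum_castAdd_lt_castAdd (i j : Fin n) :
    skewSum α β (Fin.castAdd m i) < skewSum α β (Fin.castAdd m j) ↔ α i < α j := by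
  simp only [Fin.lt_def, val_skewSum_castAdd, Nat.add_lt_add_iff_left]

theorem skewSum_natAdd_lt_natAdd (i j : Fin m) :
    skewSum α β (Fin.natAdd n i) < skewSum α β (Fin.natAdd n j) ↔ β i < β j := by
  simp only [Fin.lt_def, val_skewSum_natAdd]

theorem decMax_skewSum (k : ℕ) : decMax (skewSum α β) k = decMax α k + decMax β k := by
  simpa only [decMax_eq_chainMax, skewSum_castAdd_lt_castAdd, skewSum_natAdd_lt_natAdd] using
    chainMax_eq_add_of_forall (R := fun i j => skewSum α β j < skewSum α β i)
      (skewSum_natAdd_lt_castAdd α β) k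

theorem incMax_add_incMax_le_incMax_skewSum (k l : ℕ) :
    incMax α k + incMax β l ≤ incMax (skewSum α β) (k + l) := by
  simpa only [incMax_eq_chainMax, skewSum_castAdd_lt_castAdd, skewSum_natAdd_lt_natAdd] using
    chainMax_add_chainMax_le (fun i j => skewSum α β i < skewSum α β j) k l

theorem exists_incMax_skewSum_le (k : ℕ) :
    ∃ a b : ℕ, a + b ≤ k ∧ incMax (skewSum α β) k ≤ incMax α a + incMax β b := by
  simpa only [incMax_eq_chainMax, skewSum_castAdd_lt_castAdd, skewSum_natAdd_lt_natAdd] using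
    exists_chainMax_le_add (R := fun i j => skewSum α β i < skewSum α β j)
      (fun i j => (skewSum_natAdd_lt_castAdd α β i j).not_gt) k

end SkewSum

theorem shape_of_skewSum {n m : ℕ} (α : Equiv.Perm (Fin n)) (β : Equiv.Perm (Fin m)) :
    (∀ lamα lamβ nu : YPartition, HasShape α lamα → HasShape β lamβ →
      (∀ i : ℕ, conjParts nu i = conjParts lamα i + conjParts lamβ i) →
      HasShape (skewSum α β) nu) ∧
    (∀ k : ℕ, 1 ≤ k → decMax (skewSum α β) k = decMax α k + decMax β k) := by
  refine ⟨fun lamα lamβ nu hα hβ h k => ⟨le_antisymm ?_ ?_, ?_⟩, fun k _ => decMax_skewSum α β k⟩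
  · obtain ⟨i, j, rfl, hij⟩ := exists_psum_le_psum_add_psum_of_conjParts_eq_add h k
    rw [(hα i).1, (hβ j).1] at hij
    exact hij.trans (incMax_add_incMax_le_incMax_skewSum α β i j)
  · obtain ⟨a, b, hab, hle⟩ := exists_incMax_skewSum_le α β k
    rw [← (hα a).1, ← (hβ b).1] at hle
    exact hle.trans ((psum_add_psum_le_of_conjParts_eq_add h a b).trans (psum_mono _ hab))
  · rw [decMax_skewSum, ← (hα k).2, ← (hβ k).2]
    simp only [psum, h, Finset.sum_add_distrib]
end
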